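/- arXiv:2104.10199 — 2 statements merged into one kernel-verified Lean document; each statement's English description precedes it below -/
import Mathlib

section
/- Let (X,*) be a finite quandle and a ∈ X. Suppose that the cycles of the right translation R_a have pairwise distinct lengths (counting fixed points as 1-cycles), and that for every i ∈ X the only fixed point of R_i is i. Then the left translation L_a maps each cycle of R_a into itself: for every x ∈ X, the element a*x lies in the R_a-cycle of x (some iterate of R_a maps x to a*x). -/
/-- Let `(X, *)` be a finite quandle and `a ∈ X`. If the cycles of `R_a` have pairwise
distinct lengths and every right translation `R_i` has `i` as its only fixed point, then
`L_a` maps each cycle of `R_a` into itself: `a * x` lies in the `R_a`-cycle of `x`. -/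
theorem left_translation_preserves_cycles
    {X : Type*} [Finite X] (op : X → X → X) (a : X)
    (hidem : ∀ i : X, op i i = i)
    (hrinv : ∀ i : X, Function.Bijective (fun x => op x i))
    (hdistrib : ∀ i j k : X, op (op i j) k = op (op i k) (op j k))
    (hdist : ∀ x y : X,
      Function.minimalPeriod (fun z => op z a) x = Function.minimalPeriod (fun z => op z a) y →
      ∃ n : ℕ, (fun z => op z a)^[n] x = y)
    (hfix : ∀ i x : X, op x i = x → x = i) :
    ∀ x : X, ∃ m : ℕ, (fun z => op z a)^[m] x = op a x := by
  set f : X → X := fun z => op z a with hf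
  have hfop : ∀ u v, f (op u v) = op (f u) (f v) := fun u v => hdistrib u v a
  have hfn : ∀ n : ℕ, ∀ u v, f^[n] (op u v) = op (f^[n] u) (f^[n] v) := by
    intro n
    induction n with
    | zero => intro u v; rfl
    | succ n ih => intro u v; simp only [Function.iterate_succ_apply, hfop, ih]
  have hfa : f a = a := hidem a
  have hfna : ∀ n : ℕ, f^[n] a = a := fun n => Function.iterate_fixed hfa n
  have hL : ∀ n : ℕ, ∀ u, f^[n] (op a u) = op a (f^[n] u) := by
    intro n u
    rw [hfn, hfna]
  have hpos : ∀ u, 0 < Function.minimalPeriod f u := fun u =>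
    Function.minimalPeriod_pos_of_mem_periodicPts
      ((hrinv a).injective.mem_periodicPts u)
  have key : ∀ l : ℕ, ∀ x, Function.minimalPeriod f x = l → ∃ m : ℕ, f^[m] x = op a x := by
    intro l
    induction l using Nat.strong_induction_on with
    | _ l ih =>
    intro x hx
    have hper : f^[l] (op a x) = op a x := by
      rw [hL, ← hx, Function.iterate_minimalPeriod]
    have hdvd : Function.minimalPeriod f (op a x) ∣ l :=
      Function.IsPeriodicPt.minimalPeriod_dvd hper
    have hl : 0 < l := hx ▸ hpos x
    rcases (Nat.le_of_dvd hl hdvd).lt_or_eq with hlt | heq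
    · obtain ⟨m, hm⟩ := ih _ hlt (op a x) rfl
      set b := op a x with hb
      set d := Function.minimalPeriod f b with hd
      have hd0 : 0 < d := hpos b
      have hdb : f^[d] b = b := Function.iterate_minimalPeriod
      obtain ⟨z, hz, hzd⟩ : ∃ z, op a z = b ∧ f^[d] z = z := by
        refine ⟨f^[m * (d - 1)] b, ?_, ?_⟩
        · rw [← hL, ← hm, ← Function.iterate_add_apply]
          have : m * (d - 1) + m = d * m := by
            obtain ⟨e, he⟩ := Nat.exists_eq_succ_of_ne_zero hd0.ne'
            rw [he]; simp; ring
          rw [this, Function.iterate_mul]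
          exact Function.iterate_fixed hdb m
        · rw [← Function.iterate_add_apply, add_comm, Function.iterate_add_apply, hdb]
      have hc : ∀ w, ∃ v, op v z = op w x := fun w => (hrinv z).surjective (op w x)
      choose c hc using hc
      have hcf : ∀ w, c (f w) = f (c w) := by
        intro w
        apply (hrinv z).injective
        change op (c (f w)) z = op (op (c w) a) z
        rw [hc, hdistrib (c w) a z, hc, hz, hb]
        exact hdistrib w a x
      have hcn : ∀ n : ℕ, ∀ w, c (f^[n] w) = f^[n] (c w) := by
        intro n
        induction n with
        | zero => intro w; rfl
        | succ n ih => intro w; simp only [Function.iterate_succ_apply, hcf, ih]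
      have h1 : op (f^[d] x) x = f^[d] x := by
        rw [← hc, hcn]
        nth_rewrite 1 [← hzd]
        rw [← hfn, hc, hidem]
      have h2 : f^[d] x = x := hfix _ _ h1
      have h3 : l ≤ d := hx ▸ Function.IsPeriodicPt.minimalPeriod_le hd0 h2
      omega
    · exact hdist x (op a x) (by rw [hx, heq])
  exact fun x => key _ x rfl
end

section
/- Let (X,*) be a finite connected quandle whose profile has no repeats, i.e., for some (equivalently, every) i ∈ X, no two cycles in the disjoint cycle decomposition of the right translation R_i (counting fixed points as 1-cycles) have the same length. Then (X,*) is a latin quandle: every left translation L_i : X → X, j ↦ i*j, is a bijection. -/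
namespace QuandleAux

variable {X : Type*} (R : X → Equiv.Perm X)

/-- `R` is equivariant for the group generated by a set of right translations. -/
lemma conj_of_mem (hc : ∀ k x, R (R k x) = R k * R x * (R k)⁻¹) {g : Equiv.Perm X}
    (hg : g ∈ Subgroup.closure (Set.range R)) : ∀ x, R (g x) = g * R x * g⁻¹ := by
  induction hg using Subgroup.closure_induction with
  | mem g h => obtain ⟨k, rfl⟩ := h; exact hc k
  | one => intro x; simp
  | mul a b _ _ iha ihb =>
    intro x
    rw [Equiv.Perm.mul_apply, iha, ihb]; group
  | inv a _ iha =>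
    intro x
    have := iha (a⁻¹ x)
    rw [show a (a⁻¹ x) = x by simp] at this
    rw [this]; group

/-- The points of `S` fixed by `A`. -/
def fx (S : Set X) (A : Equiv.Perm X) : Set X := {y | y ∈ S ∧ A y = y}

/-- Connectedness of a subset. -/
def Conn (S : Set X) : Prop :=
  ∀ x ∈ S, ∀ y ∈ S, ∃ g ∈ Subgroup.closure (R '' S), g x = y

lemma mem_range_closure {S : Set X} {g : Equiv.Perm X}
    (hg : g ∈ Subgroup.closure (R '' S)) : g ∈ Subgroup.closure (Set.range R) :=
  Subgroup.closure_mono (Set.image_subset_range R S) hg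

lemma pow_mem_range (i : X) (m : ℕ) : R i ^ m ∈ Subgroup.closure (Set.range R) :=
  Subgroup.pow_mem _ (Subgroup.subset_closure (Set.mem_range_self i)) m

lemma commute_of_fix (hc : ∀ k x, R (R k x) = R k * R x * (R k)⁻¹) {A : Equiv.Perm X}
    (hA : A ∈ Subgroup.closure (Set.range R)) {y : X} (hy : A y = y) : Commute A (R y) := by
  have := conj_of_mem R hc hA y
  rw [hy] at this
  exact (eq_mul_inv_iff_mul_eq.mp this).symm

lemma fx_closed (hc : ∀ k x, R (R k x) = R k * R x * (R k)⁻¹) {S : Set X}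
    (hS : ∀ x ∈ S, ∀ y ∈ S, R y x ∈ S) {A : Equiv.Perm X}
    (hA : A ∈ Subgroup.closure (Set.range R)) :
    ∀ x ∈ fx S A, ∀ y ∈ fx S A, R y x ∈ fx S A := by
  rintro x ⟨hx, hAx⟩ y ⟨hy, hAy⟩
  refine ⟨hS x hx y hy, ?_⟩
  have h := commute_of_fix R hc hA hAy
  have h2 : (A * R y) x = (R y * A) x := by rw [h.eq]
  simpa [hAx] using h2

/-- The key step. -/
lemma key (hc : ∀ k x, R (R k x) = R k * R x * (R k)⁻¹)
    (hi : ∀ i, R i i = i) (huniq : ∀ i x, R i x = x → x = i)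
    {S : Set X} {i j : X} {m : ℕ} (hiS : i ∈ S) (huS : R j i ∈ S)
    (hfix : (R i ^ m) (R j i) = R j i) (hconn : Conn R (fx S (R i ^ m))) :
    (R i ^ m) j = j := by
  have hAi : (R i ^ m) i = i := by
    have : Function.IsFixedPt (R i) i := hi i
    rw [Equiv.Perm.coe_pow]
    exact this.iterate m
  obtain ⟨g, hg, hgi⟩ := hconn i ⟨hiS, hAi⟩ (R j i) ⟨huS, hfix⟩
  have hcomm : Commute (R i ^ m) g := by
    have : Subgroup.closure (R '' (fx S (R i ^ m))) ≤ Subgroup.centralizer {R i ^ m} := by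
      rw [Subgroup.closure_le]
      rintro _ ⟨y, ⟨_, hy⟩, rfl⟩
      rw [SetLike.mem_coe, Subgroup.mem_centralizer_singleton_iff]
      exact ((commute_of_fix R hc (pow_mem_range R i m) hy).eq).symm
    exact (Subgroup.mem_centralizer_singleton_iff.mp (this hg)).symm
  have h1 : R (R j i) ^ m = R i ^ m := by
    rw [← hgi, conj_of_mem R hc (mem_range_closure R hg), conj_pow, ← hcomm.eq]; group
  have h2 : R j * R i ^ m * (R j)⁻¹ = R i ^ m := by
    rw [← conj_pow, ← hc, h1]
  apply huniq
  have h3 : (R j * R i ^ m) j = (R i ^ m * R j) j := by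
    rw [mul_inv_eq_iff_eq_mul.mp h2]
  simpa [hi] using h3

lemma closure_maps [Finite X] {S : Set X}
    (hS : ∀ x ∈ S, ∀ y ∈ S, R y x ∈ S) {g : Equiv.Perm X}
    (hg : g ∈ Subgroup.closure (R '' S)) : ∀ x, x ∈ S → g x ∈ S := by
  induction hg using Subgroup.closure_induction with
  | mem g h => obtain ⟨k, hk, rfl⟩ := h; exact fun x hx => hS x hx k hk
  | one => intro x hx; simpa
  | mul a b _ _ iha ihb => exact fun x hx => iha _ (ihb x hx)
  | inv a _ iha =>
    intro x hx
    have himg : a '' S = S := Set.eq_of_subset_of_ncard_le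
      (by rintro _ ⟨y, hy, rfl⟩; exact iha y hy)
      (Set.ncard_image_of_injective S a.injective).ge (Set.toFinite S)
    obtain ⟨y, hy, hxy⟩ : x ∈ a '' S := himg.symm ▸ hx
    have : a⁻¹ x = y := by rw [← hxy]; simp
    rwa [this]

/-- A closed subset of a finite quandle without repeats is connected. -/
lemma conn_all [Finite X] (hc : ∀ k x, R (R k x) = R k * R x * (R k)⁻¹)
    (hi : ∀ i, R i i = i) (huniq : ∀ i x, R i x = x → x = i)
    (hN : ∀ i x y, (∀ n : ℕ, (R i ^ n) x = x ↔ (R i ^ n) y = y) → ∃ n : ℕ, (R i ^ n) x = y) :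
    ∀ N : ℕ, ∀ S : Set X, S.ncard = N → (∀ x ∈ S, ∀ y ∈ S, R y x ∈ S) → Conn R S := by
  intro N
  induction N using Nat.strong_induction_on with
  | _ N ih =>
  intro S hSN hS
  have hpowi : ∀ i m, (R i ^ m) i = i := fun i m => by
    have : Function.IsFixedPt (R i) i := hi i
    rw [Equiv.Perm.coe_pow]
    exact this.iterate m
  -- fixed subsets are connected unless everything is fixed
  have hfx : ∀ i m, (∃ z ∈ S, (R i ^ m) z ≠ z) → Conn R (fx S (R i ^ m)) := by
    rintro i m ⟨z, hz, hne⟩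
    refine ih _ ?_ _ rfl (fx_closed R hc hS (pow_mem_range R i m))
    rw [← hSN]
    refine Set.ncard_lt_ncard ⟨fun y hy => hy.1, fun h => hne (h hz).2⟩ (Set.toFinite S)
  set G := Subgroup.closure (R '' S) with hG
  let O : X → Set X := fun i => {y | ∃ g ∈ G, g i = y}
  have hOS : ∀ i ∈ S, O i ⊆ S := by
    rintro i hi' _ ⟨g, hg, rfl⟩
    exact closure_maps R hS hg i hi'
  -- the main contradiction
  have main : ∀ i ∈ S, ∀ x ∈ S, x ∉ O i → (O i).ncard ≤ (O x).ncard → False := by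
    intro i hiS x hxS hx hle
    have hdiv : ∀ y ∈ S, y ∉ O i → ∀ n, (R i ^ n) y = y → ∀ z ∈ S, (R i ^ n) z = z := by
      intro y hy hyO n hn z hz
      by_contra hne
      obtain ⟨g, hg, hgy⟩ := hfx i n ⟨z, hz, hne⟩ i ⟨hiS, hpowi i n⟩ y ⟨hy, hn⟩
      exact hyO ⟨g, Subgroup.closure_mono (Set.image_mono (fun y hy => hy.1)) hg, hgy⟩
    have hdisj : ∀ y ∈ O x, y ∉ O i := by
      rintro _ ⟨g, hg, rfl⟩ ⟨k, hk, hki⟩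
      exact hx ⟨g⁻¹ * k, G.mul_mem (G.inv_mem hg) hk, by simp [hki]⟩
    have hfin : ∀ z, 0 < Function.minimalPeriod (R i) z := fun z =>
      Function.minimalPeriod_pos_of_mem_periodicPts
        ((R i).injective.mem_periodicPts z)
    -- size of the cycle of x
    have hcard1 : (O x).ncard ≤ Function.minimalPeriod (R i) x := by
      have hsub : O x ⊆ (fun n => (R i)^[n] x) '' (Set.Iio (Function.minimalPeriod (R i) x)) := by
        intro y hy
        have hyS := hOS x hxS hy
        obtain ⟨n, hn⟩ := hN i x y (fun n => ⟨fun h => hdiv x hxS hx n h y hyS,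
          fun h => hdiv y hyS (hdisj y hy) n h x hxS⟩)
        refine ⟨n % Function.minimalPeriod (R i) x, Nat.mod_lt _ (hfin x), ?_⟩
        simp only [Function.iterate_mod_minimalPeriod_eq]
        rw [← hn, Equiv.Perm.coe_pow]
      calc (O x).ncard ≤ _ := Set.ncard_le_ncard hsub (Set.toFinite _)
        _ ≤ _ := Set.ncard_image_le (Set.finite_Iio _)
        _ = _ := by simp [Set.ncard_eq_toFinset_card']
    -- size of the cycle of u
    have hmemO : ∀ k ∈ S, ∀ y ∈ O i, R k y ∈ O i := by
      rintro k hk _ ⟨g, hg, rfl⟩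
      exact ⟨R k * g, G.mul_mem (Subgroup.subset_closure ⟨k, hk, rfl⟩) hg, rfl⟩
    have hiO : i ∈ O i := ⟨1, G.one_mem, rfl⟩
    have huO : R x i ∈ O i := hmemO x hxS i hiO
    have hui : R x i ≠ i := by
      intro h
      have := huniq x i h
      exact hx (this ▸ hiO)
    have hcard2 : Function.minimalPeriod (R i) (R x i) < (O i).ncard := by
      have hsub : (fun n => (R i)^[n] (R x i)) ''
          (Set.Iio (Function.minimalPeriod (R i) (R x i))) ⊂ O i := by
        refine ⟨?_, fun h => ?_⟩
        · rintro _ ⟨n, hn, rfl⟩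
          clear hn
          show (R i)^[n] (R x i) ∈ O i
          induction n with
          | zero => exact huO
          | succ n ihn => rw [Function.iterate_succ_apply']; exact hmemO i hiS _ ihn
        · obtain ⟨n, _, hn⟩ := h hiO
          apply hui
          have h2 := hpowi i n
          rw [Equiv.Perm.coe_pow] at h2
          exact ((R i).injective.iterate n) (hn.trans h2.symm)
      have h1 := Set.ncard_lt_ncard hsub (Set.toFinite _)
      rw [Set.InjOn.ncard_image Function.iterate_injOn_Iio_minimalPeriod] at h1
      simpa [Set.ncard_eq_toFinset_card'] using h1
    set m := Function.minimalPeriod (R i) (R x i) with hm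
    have hxm : (R i ^ m) x ≠ x := by
      intro h
      rw [Equiv.Perm.coe_pow] at h
      have : Function.minimalPeriod (R i) x ≤ m :=
        Function.IsPeriodicPt.minimalPeriod_le (hfin _) h
      omega
    refine hxm (key R hc hi huniq hiS (hS i hiS x hxS) ?_ (hfx i m ⟨x, hxS, hxm⟩))
    rw [Equiv.Perm.coe_pow]
    exact Function.iterate_minimalPeriod
  intro x hx y hy
  by_contra hno
  have h1 : y ∉ O x := hno
  have h2 : x ∉ O y := by
    rintro ⟨g, hg, hgx⟩
    exact h1 ⟨g⁻¹, G.inv_mem hg, by simp [← hgx]⟩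
  rcases le_total (O x).ncard (O y).ncard with h | h
  · exact main x hx y hy h1 h
  · exact main y hy x hx h2 h

end QuandleAux

/-- A finite connected quandle whose profile has no repeats (i.e. for some right
translation, no two of its cycles have the same length) is latin. -/
theorem connected_quandle_profile_no_repeats_is_latin
    {X : Type*} [Finite X] (op : X → X → X) (R : X → Equiv.Perm X)
    (hR : ∀ i x : X, R i x = op x i)
    (hidem : ∀ i : X, op i i = i)
    (hdistrib : ∀ i j k : X, op (op i j) k = op (op i k) (op j k))
    (hconn : ∀ x y : X, ∃ g ∈ Subgroup.closure (Set.range R), g x = y)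
    (hdist : ∃ i : X, ∀ x y : X,
      Function.minimalPeriod (fun z => op z i) x = Function.minimalPeriod (fun z => op z i) y →
      ∃ n : ℕ, (fun z => op z i)^[n] x = y) :
    ∀ i : X, Function.Bijective (fun j => op i j) := by
  have hc : ∀ k x, R (R k x) = R k * R x * (R k)⁻¹ := by
    intro k x
    rw [eq_mul_inv_iff_mul_eq]
    ext z
    simp only [Equiv.Perm.mul_apply, hR]
    exact (hdistrib z x k).symm
  have hi : ∀ i, R i i = i := fun i => by rw [hR, hidem]
  have hpowi : ∀ i m, (R i ^ m) i = i := fun i m => by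
    have : Function.IsFixedPt (R i) i := hi i
    rw [Equiv.Perm.coe_pow]
    exact this.iterate m
  have hN : ∀ i x y, (∀ n : ℕ, (R i ^ n) x = x ↔ (R i ^ n) y = y) →
      ∃ n : ℕ, (R i ^ n) x = y := by
    obtain ⟨i₀, h₀⟩ := hdist
    have hfun : (fun z => op z i₀) = R i₀ := by ext z; rw [hR]
    rw [hfun] at h₀
    intro i x y h
    obtain ⟨g, hg, rfl⟩ := hconn i₀ i
    have hpow : ∀ n z, (R (g i₀) ^ n) z = g ((R i₀ ^ n) (g⁻¹ z)) := by
      intro n z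
      rw [QuandleAux.conj_of_mem R hc hg, conj_pow]; rfl
    obtain ⟨n, hn⟩ := h₀ (g⁻¹ x) (g⁻¹ y) (by
      rw [Function.minimalPeriod_eq_minimalPeriod_iff]
      intro n
      have := h n
      rw [hpow, hpow] at this
      simp only [Function.IsPeriodicPt, Function.IsFixedPt, ← Equiv.Perm.coe_pow]
      rwa [Equiv.Perm.eq_inv_iff_eq, Equiv.Perm.eq_inv_iff_eq])
    refine ⟨n, ?_⟩
    rw [hpow, Equiv.Perm.coe_pow, hn]; simp
  have huniq : ∀ i x, R i x = x → x = i := by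
    intro i x hx
    have hx' : ∀ n : ℕ, (R i ^ n) x = x := fun m => by
      have : Function.IsFixedPt (R i) x := hx
      rw [Equiv.Perm.coe_pow]
      exact this.iterate m
    obtain ⟨n, hn⟩ := hN i x i (fun n => by simp [hx', hpowi])
    rw [← hn, hx']
  intro i
  rw [← Finite.surjective_iff_bijective]
  have hcomm : ∀ n j, op i ((R i ^ n) j) = (R i ^ n) (op i j) := by
    intro n
    induction n with
    | zero => intro j; rfl
    | succ n ih =>
      intro j
      rw [pow_succ, Equiv.Perm.mul_apply, Equiv.Perm.mul_apply, ih]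
      congr 1
      rw [hR, hR, hdistrib, hidem]
  intro j
  obtain ⟨n, hn⟩ := hN i (op i j) j (fun n => ⟨fun h => by
      rw [← hR j i] at h
      exact QuandleAux.key R hc hi huniq (S := Set.univ) trivial trivial h
        (QuandleAux.conn_all R hc hi huniq hN _ _ rfl
          (QuandleAux.fx_closed R hc (S := Set.univ) (fun _ _ _ _ => trivial) (QuandleAux.pow_mem_range R i n))),
    fun h => by rw [← hcomm, h]⟩)
  exact ⟨(R i ^ n) j, by simp only [hcomm, hn]⟩
end
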